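/- arXiv:1209.5266 — 2 statements merged into one kernel-verified Lean document; each statement's English description precedes it below -/
import Mathlib

section
/- The number of 'good' pairs (F1, F2) in H^0(P^1_{F_{q^e}}, O(n))^2, i.e., pairs of homogeneous binary forms of degree n over F_{q^e} such that F1 is nonzero and no geometric point of P^1 is simultaneously a multiple root of F1 and a root of F2, equals q^{e(2n+2)}·(1 - q^{-2e}) if n=1, q^{e(2n+2)}·(1 - q^{-2e} - q^{-3e} + q^{-4e}) if n=2, and q^{e(2n+2)}·(1 - q^{-2e} - q^{-3e} + q^{-5e}) if n≥3. -/
open MvPolynomial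

/-- The homogeneous binary form of degree `n` with coefficient vector `c`. -/
noncomputable def form (F : Type*) [Field F] (n : ℕ) (c : Fin (n + 1) → F) :
    MvPolynomial (Fin 2) F :=
  ∑ i : Fin (n + 1), C (c i) * X 0 ^ (i : ℕ) * X 1 ^ (n - (i : ℕ))

/-- The linear form cutting out the point `[a : b]` of `P^1`. -/
noncomputable def lin {K : Type*} [Field K] (a b : K) : MvPolynomial (Fin 2) K :=
  C b * X 0 - C a * X 1

/-- A pair of binary forms (of degrees `n₁`, `n₂`) is good if the first is nonzero and
no geometric point of `P^1` is simultaneously a multiple root of the first form and a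
root of the second. -/
def GoodPair {F : Type*} [Field F] {n₁ n₂ : ℕ} (c₁ : Fin (n₁ + 1) → F)
    (c₂ : Fin (n₂ + 1) → F) : Prop :=
  form F n₁ c₁ ≠ 0 ∧ ∀ a b : AlgebraicClosure F, (a ≠ 0 ∨ b ≠ 0) →
    ¬ (lin a b ^ 2 ∣ (form F n₁ c₁).map (algebraMap F (AlgebraicClosure F)) ∧
       lin a b ∣ (form F n₂ c₂).map (algebraMap F (AlgebraicClosure F)))

open Polynomial in
/-- Pairs of polynomials, the first one nonzero, such that no nonconstant polynomial divides the
second one while its square divides the first one, with the degrees bounded by `a` and `b`. -/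
def affSet (F : Type*) [Field F] (a b : ℕ) : Set (F[X] × F[X]) :=
  {x | x.1.natDegree ≤ a ∧ x.2.natDegree ≤ b ∧ x.1 ≠ 0 ∧
    ∀ d : F[X], d ^ 2 ∣ x.1 → d ∣ x.2 → IsUnit d}

open Polynomial in
/-- Pairs of polynomials, the first one nonzero, with the degrees bounded by `a` and `b`. -/
def degSet (F : Type*) [Field F] (a b : ℕ) : Set (F[X] × F[X]) :=
  {x | x.1.natDegree ≤ a ∧ x.2.natDegree ≤ b ∧ x.1 ≠ 0}

section Counting

open Polynomial

variable {F : Type*} [Field F]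

lemma affSet_subset_degSet (a b : ℕ) : affSet F a b ⊆ degSet F a b :=
  fun _ hx => ⟨hx.1, hx.2.1, hx.2.2.1⟩

lemma affSet_mono {a a' b b' : ℕ} (ha : a ≤ a') (hb : b ≤ b') : affSet F a b ⊆ affSet F a' b' :=
  fun _ hx => ⟨hx.1.trans ha, hx.2.1.trans hb, hx.2.2⟩

lemma setOf_natDegree_le_eq_degreeLT (a : ℕ) :
    {p : F[X] | p.natDegree ≤ a} = (degreeLT F (a + 1) : Set F[X]) := by
  ext p
  simp only [Set.mem_ofPred_eq, SetLike.mem_coe, mem_degreeLT, degree_lt_iff_coeff_zero,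
    natDegree_le_iff_coeff_eq_zero, Nat.lt_iff_add_one_le]

lemma degSet_eq_prod (a b : ℕ) :
    degSet F a b = ({p : F[X] | p.natDegree ≤ a} \ {0}) ×ˢ {p : F[X] | p.natDegree ≤ b} := by
  ext x
  simp only [degSet, Set.mem_ofPred_eq, Set.mem_prod, Set.mem_sdiff, Set.mem_singleton_iff]
  tauto

lemma natDegree_sq_mul_le_iff {d p : F[X]} (hd : d ≠ 0) (hp : p ≠ 0) {k a : ℕ}
    (hk : d.natDegree = k) (hka : 2 * k ≤ a) :
    (d ^ 2 * p).natDegree ≤ a ↔ p.natDegree ≤ a - 2 * k := by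
  rw [natDegree_mul (pow_ne_zero 2 hd) hp, natDegree_pow, hk]
  omega

lemma natDegree_mul_le_iff_of_natDegree_eq {d r : F[X]} (hd : d ≠ 0) {k b : ℕ}
    (hk : d.natDegree = k) (hkb : k ≤ b) :
    (d * r).natDegree ≤ b ↔ r.natDegree ≤ b - k := by
  rcases eq_or_ne r 0 with rfl | hr
  · simp
  rw [natDegree_mul hd hr, hk]
  omega

lemma exists_monic_maximal {p : F[X]} (r : F[X]) (hp : p ≠ 0) :
    ∃ d p' r' : F[X], d.Monic ∧ p = d ^ 2 * p' ∧ r = d * r' ∧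
      ∀ e : F[X], e ^ 2 ∣ p' → e ∣ r' → IsUnit e := by
  induction hN : p.natDegree using Nat.strong_induction_on generalizing p r with
  | _ N ih =>
    by_cases H : ∀ e : F[X], e ^ 2 ∣ p → e ∣ r → IsUnit e
    · exact ⟨1, p, r, monic_one, by simp, by simp, H⟩
    · push Not at H
      obtain ⟨e, ⟨p₁, hp₁⟩, ⟨r₁, hr₁⟩, he⟩ := H
      have he0 : e ≠ 0 := by rintro rfl; simp at hp₁; exact hp hp₁
      have hp₁0 : p₁ ≠ 0 := by rintro rfl; simp at hp₁; exact hp hp₁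
      have hdeg : 0 < e.natDegree := by
        rw [Nat.pos_iff_ne_zero]
        intro h0
        exact he (isUnit_iff_degree_eq_zero.2 ((degree_eq_iff_natDegree_eq he0).2 h0))
      obtain ⟨d, p', r', hd, h1, h2, h3⟩ := ih p₁.natDegree (by
        rw [← hN, hp₁, natDegree_mul (pow_ne_zero 2 he0) hp₁0, natDegree_pow]; omega) r₁ hp₁0 rfl
      have hlc : e.leadingCoeff ≠ 0 := leadingCoeff_ne_zero.2 he0
      refine ⟨(e * Polynomial.C e.leadingCoeff⁻¹) * d, Polynomial.C (e.leadingCoeff ^ 2) * p',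
        Polynomial.C e.leadingCoeff * r', (monic_mul_leadingCoeff_inv he0).mul hd, ?_, ?_, ?_⟩
      · have : (Polynomial.C e.leadingCoeff⁻¹ : F[X]) ^ 2 * Polynomial.C (e.leadingCoeff ^ 2) = 1 := by
          rw [← Polynomial.C_pow, ← Polynomial.C_mul]; simp [hlc]
        rw [hp₁, h1]
        linear_combination (-(e ^ 2 * d ^ 2 * p')) * this
      · have : (Polynomial.C e.leadingCoeff⁻¹ : F[X]) * Polynomial.C (e.leadingCoeff) = 1 := by
          rw [← Polynomial.C_mul]; simp [hlc]
        rw [hr₁, h2]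
        linear_combination (-(e * d * r')) * this
      · intro f hf hf'
        refine h3 f ?_ ?_
        · exact ((isUnit_C.2 (hlc.isUnit.pow 2)).dvd_mul_left).1 hf
        · exact ((isUnit_C.2 hlc.isUnit).dvd_mul_left).1 hf'

lemma monic_eq_of_sq_mul_eq {d e p p' r r' : F[X]} (hd : d.Monic) (he : e.Monic)
    (hp : ∀ f : F[X], f ^ 2 ∣ p → f ∣ r → IsUnit f)
    (hp' : ∀ f : F[X], f ^ 2 ∣ p' → f ∣ r' → IsUnit f)
    (h1 : d ^ 2 * p = e ^ 2 * p') (h2 : d * r = e * r') : d = e := by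
  classical
  obtain ⟨d', e', hcop, hd', he'⟩ : ∃ d' e' : F[X], IsCoprime d' e' ∧
      d = EuclideanDomain.gcd d e * d' ∧ e = EuclideanDomain.gcd d e * e' := by
    obtain ⟨d', hd'⟩ := EuclideanDomain.gcd_dvd_left d e
    obtain ⟨e', he'⟩ := EuclideanDomain.gcd_dvd_right d e
    refine ⟨d', e', ?_, hd', he'⟩
    have hb := EuclideanDomain.gcd_eq_gcd_ab d e
    have hg : EuclideanDomain.gcd d e ≠ 0 := fun h => hd.ne_zero (by rw [hd', h, zero_mul])
    refine ⟨EuclideanDomain.gcdA d e, EuclideanDomain.gcdB d e, mul_left_cancel₀ hg ?_⟩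
    linear_combination -hb - EuclideanDomain.gcdA d e * hd' - EuclideanDomain.gcdB d e * he'
  generalize EuclideanDomain.gcd d e = g at hd' he'
  have hg : g ≠ 0 := fun h => hd.ne_zero (by rw [hd', h, zero_mul])
  have h1' : d' ^ 2 * p = e' ^ 2 * p' := by
    refine mul_left_cancel₀ (pow_ne_zero 2 hg) ?_
    rw [hd', he'] at h1
    linear_combination h1
  have h2' : d' * r = e' * r' := by
    refine mul_left_cancel₀ hg ?_
    rw [hd', he'] at h2
    linear_combination h2
  have hud : IsUnit d' := hp' d' ((hcop.pow (m := 2) (n := 2)).dvd_of_dvd_mul_left ⟨p, h1'.symm⟩)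
    (hcop.dvd_of_dvd_mul_left ⟨r, h2'.symm⟩)
  have hue : IsUnit e' := hp e' ((hcop.symm.pow (m := 2) (n := 2)).dvd_of_dvd_mul_left ⟨p', h1'⟩)
    (hcop.symm.dvd_of_dvd_mul_left ⟨r', h2'⟩)
  refine eq_of_monic_of_associated hd he ?_
  rw [hd', he']
  exact (Associated.refl g).mul_mul
    ((associated_one_iff_isUnit.2 hud).trans (associated_one_iff_isUnit.2 hue).symm)

lemma natCard_degreeLT (n : ℕ) : Nat.card (degreeLT F n) = Nat.card F ^ n := by
  rw [Nat.card_congr (degreeLTEquiv F n).toEquiv, Nat.card_fun, Nat.card_fin]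

lemma ncard_setOf_natDegree_le (a : ℕ) :
    {p : F[X] | p.natDegree ≤ a}.ncard = Nat.card F ^ (a + 1) := by
  rw [setOf_natDegree_le_eq_degreeLT, ← Nat.card_coe_set_eq]
  exact natCard_degreeLT (a + 1)

lemma card_monic_natDegree_eq (k : ℕ) :
    Nat.card {p : F[X] // p.Monic ∧ p.natDegree = k} = Nat.card F ^ k := by
  rw [Nat.card_congr (monicEquivDegreeLT k), natCard_degreeLT]

lemma ncard_degSet (a b : ℕ) :
    (degSet F a b).ncard = (Nat.card F ^ (a + 1) - 1) * Nat.card F ^ (b + 1) := by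
  rw [degSet_eq_prod, Set.ncard_prod, Set.ncard_sdiff_singleton_of_mem (by simp),
    ncard_setOf_natDegree_le, ncard_setOf_natDegree_le]

variable [Finite F]

lemma finite_setOf_natDegree_le (a : ℕ) : {p : F[X] | p.natDegree ≤ a}.Finite := by
  rw [setOf_natDegree_le_eq_degreeLT]
  exact Finite.of_equiv _ (degreeLTEquiv F (a + 1)).toEquiv.symm

lemma finite_degSet (a b : ℕ) : (degSet F a b).Finite := by
  rw [degSet_eq_prod]
  exact (finite_setOf_natDegree_le a).sdiff.prod (finite_setOf_natDegree_le b)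

lemma finite_affSet (a b : ℕ) : (affSet F a b).Finite :=
  (finite_degSet a b).subset (affSet_subset_degSet a b)

lemma ncard_degSet_eq_sum {a b : ℕ} (hab : a / 2 ≤ b) :
    (degSet F a b).ncard = ∑ k ∈ Finset.range (a / 2 + 1),
      Nat.card F ^ k * (affSet F (a - 2 * k) (b - k)).ncard := by
  rw [Finset.sum_range]
  have hfin : ∀ k : ℕ, Finite {p : F[X] // p.Monic ∧ p.natDegree = k} := fun k =>
    Finite.of_equiv _ ((monicEquivDegreeLT k).trans (degreeLTEquiv F k).toEquiv).symm
  have hfin' : ∀ a b : ℕ, Finite (affSet F a b) := fun a b => finite_affSet a b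
  simp_rw [← card_monic_natDegree_eq, ← Nat.card_coe_set_eq, ← Nat.card_prod]
  rw [← Nat.card_sigma]
  symm
  have hmem : ∀ (k : Fin (a / 2 + 1)) (d p r : F[X]), d.Monic → d.natDegree = k →
      (p, r) ∈ affSet F (a - 2 * k) (b - k) → (d ^ 2 * p, d * r) ∈ degSet F a b := by
    intro k d p r hd hk hx
    refine ⟨?_, ?_, mul_ne_zero (pow_ne_zero 2 hd.ne_zero) hx.2.2.1⟩
    · exact (natDegree_sq_mul_le_iff hd.ne_zero hx.2.2.1 hk (by omega)).2 hx.1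
    · exact (natDegree_mul_le_iff_of_natDegree_eq hd.ne_zero hk (by omega)).2 hx.2.1
  refine Nat.card_eq_of_bijective (fun x => ⟨(x.2.1.1 ^ 2 * x.2.2.1.1, x.2.1.1 * x.2.2.1.2),
    hmem x.1 _ _ _ x.2.1.2.1 x.2.1.2.2 x.2.2.2⟩) ⟨?_, ?_⟩
  · rintro ⟨k, ⟨d, hd, hk⟩, ⟨⟨p, r⟩, hx⟩⟩ ⟨k', ⟨d', hd', hk'⟩, ⟨⟨p', r'⟩, hx'⟩⟩ h
    simp only [Subtype.mk.injEq, Prod.mk.injEq] at h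
    obtain rfl := monic_eq_of_sq_mul_eq hd hd' hx.2.2.2 hx'.2.2.2 h.1 h.2
    obtain rfl : k = k' := Fin.ext (hk.symm.trans hk')
    obtain rfl := mul_left_cancel₀ (pow_ne_zero 2 hd.ne_zero) h.1
    obtain rfl := mul_left_cancel₀ hd.ne_zero h.2
    rfl
  · rintro ⟨⟨p, r⟩, hp, hr, hp0⟩
    simp only at hp hr hp0
    obtain ⟨d, p', r', hd, rfl, rfl, hgood⟩ := exists_monic_maximal r hp0
    have hp'0 : p' ≠ 0 := right_ne_zero_of_mul hp0
    have hk : 2 * d.natDegree ≤ a := by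
      rw [natDegree_mul (pow_ne_zero 2 hd.ne_zero) hp'0, natDegree_pow] at hp
      omega
    exact ⟨⟨⟨d.natDegree, by omega⟩, ⟨d, hd, rfl⟩, ⟨(p', r'),
      (natDegree_sq_mul_le_iff hd.ne_zero hp'0 rfl hk).1 hp,
      (natDegree_mul_le_iff_of_natDegree_eq hd.ne_zero rfl (by omega)).1 hr, hp'0, hgood⟩⟩, rfl⟩

lemma ncard_affSet_eq_of_lt_two {a b : ℕ} (ha : a < 2) :
    (affSet F a b).ncard = (degSet F a b).ncard := by
  rw [ncard_degSet_eq_sum (by omega), Nat.div_eq_of_lt ha]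
  simp

lemma ncard_degSet_add_two {a b : ℕ} (hab : a / 2 ≤ b) :
    (degSet F (a + 2) (b + 1)).ncard =
      (affSet F (a + 2) (b + 1)).ncard + Nat.card F * (degSet F a b).ncard := by
  rw [ncard_degSet_eq_sum (by omega), ncard_degSet_eq_sum hab, Nat.add_div_right _ two_pos,
    Finset.sum_range_succ', Finset.mul_sum, add_comm]
  congr 1
  · simp
  · refine Finset.sum_congr rfl fun k _ => ?_
    rw [show a + 2 - 2 * (k + 1) = a - 2 * k by omega, show b + 1 - (k + 1) = b - k by omega]
    ring

end Counting

section Homogenization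

open Polynomial

variable {K : Type*} [Field K]

lemma homogenize_lin_eq (a b : K) :
    (Polynomial.C b * Polynomial.X - Polynomial.C a).homogenize 1 = lin a b := by
  simp [lin, homogenize_sub, homogenize_X]

lemma homogenize_pow_self {p : K[X]} {m : ℕ} (hp : p.natDegree ≤ m) (k : ℕ) :
    (p ^ k).homogenize (k * m) = p.homogenize m ^ k := by
  simpa using homogenize_finsetProd (s := Finset.range k) (p := fun _ => p) (n := fun _ => m)
    fun _ _ => hp

lemma lin_pow_dvd_homogenize_iff {p : K[X]} {n : ℕ} (hp : p.natDegree ≤ n) (k : ℕ) {a b : K}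
    (hb : b ≠ 0) :
    lin a b ^ k ∣ p.homogenize n ↔ (Polynomial.C b * Polynomial.X - Polynomial.C a) ^ k ∣ p := by
  have hdeg : (Polynomial.C b * Polynomial.X - Polynomial.C a).natDegree = 1 := by
    rw [sub_eq_add_neg, ← Polynomial.C_neg, natDegree_linear hb]
  constructor
  · intro h
    have := map_dvd (MvPolynomial.aeval ![Polynomial.X, (1 : K[X])]) h
    rw [aeval_homogenize_X_one p hp] at this
    simpa [lin, Polynomial.algebraMap_eq] using this
  · rintro ⟨s, rfl⟩
    rcases eq_or_ne s 0 with rfl | hs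
    · simp
    have hl : Polynomial.C b * Polynomial.X - Polynomial.C a ≠ 0 := fun h => by simp [h] at hdeg
    rw [natDegree_mul (pow_ne_zero k hl) hs, natDegree_pow, hdeg] at hp
    have hk : n = k * 1 + (n - k) := by omega
    rw [hk, homogenize_mul _ _ (by rw [natDegree_pow, hdeg]) (by omega),
      homogenize_pow_self hdeg.le, homogenize_lin_eq]
    exact dvd_mul_right _ _

lemma lin_zero_right_pow_dvd_homogenize_iff {p : K[X]} {n : ℕ} (hp : p.natDegree ≤ n) (k : ℕ)
    {a : K} (ha : a ≠ 0) :
    lin a 0 ^ k ∣ p.homogenize n ↔ p = 0 ∨ p.natDegree + k ≤ n := by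
  have hlin : Associated (lin a 0 ^ k) (MvPolynomial.X 1 ^ k) := by
    refine Associated.pow_pow ?_
    rw [show lin a 0 = MvPolynomial.C (-a) * MvPolynomial.X 1 by simp [lin]]
    exact associated_unit_mul_left _ _ ((neg_ne_zero.2 ha).isUnit.map MvPolynomial.C)
  rw [hlin.dvd_iff_dvd_left]
  constructor
  · rintro ⟨s, hs⟩
    by_contra! h
    obtain ⟨h0, h1⟩ := h
    have hcoeff := coeff_homogenize p n
      (Finsupp.single 0 p.natDegree + Finsupp.single 1 (n - p.natDegree))
    rw [hs, MvPolynomial.X_pow_eq_monomial, MvPolynomial.coeff_monomial_mul', if_neg] at hcoeff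
    · exact h0 (leadingCoeff_eq_zero.1 (by simpa [hp] using hcoeff.symm))
    · intro hle
      have := hle 1
      simp at this
      omega
  · rintro (rfl | h)
    · simp
    · have := homogenize_mul p 1 (m := n - k) (n := k) (by omega) (by simp)
      rw [mul_one, homogenize_one, Nat.sub_add_cancel (by omega)] at this
      exact this ▸ dvd_mul_left _ _

end Homogenization

section Translation

open Polynomial

variable {F : Type*} [Field F]

lemma form_eq_homogenize (n : ℕ) (c : Fin (n + 1) → F) :
    form F n c = (((degreeLTEquiv F (n + 1)).symm c : degreeLT F (n + 1)) : F[X]).homogenize n := by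
  change _ = (∑ i : Fin (n + 1), monomial (i : ℕ) (c i)).homogenize n
  rw [homogenize_finsetSum, form]
  refine Finset.sum_congr rfl fun i _ => ?_
  rw [← Polynomial.C_mul_X_pow_eq_monomial, homogenize_C_mul, homogenize_X_pow i.is_le, mul_assoc]

lemma exists_sq_dvd_iff_exists_root [PerfectField F] {L : Type*} [Field L] [Algebra F L]
    [IsAlgClosed L] [Algebra.IsAlgebraic F L] {p : F[X]} (r : F[X]) (hp : p ≠ 0) :
    (∃ α : L, (Polynomial.X - Polynomial.C α) ^ 2 ∣ p.map (algebraMap F L) ∧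
      (Polynomial.X - Polynomial.C α) ∣ r.map (algebraMap F L)) ↔
    ∃ d : F[X], d ^ 2 ∣ p ∧ d ∣ r ∧ ¬ IsUnit d := by
  constructor
  · rintro ⟨α, h1, h2⟩
    have hint : IsIntegral F α := Algebra.IsIntegral.isIntegral α
    have key : ∀ f : F[X], (Polynomial.X - Polynomial.C α) ∣ f.map (algebraMap F L) →
        minpoly F α ∣ f := by
      intro f hf
      rw [dvd_iff_isRoot, IsRoot.def, eval_map_algebraMap] at hf
      exact minpoly.dvd F α hf
    refine ⟨minpoly F α, ?_, key r h2, minpoly.not_isUnit F α⟩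
    obtain ⟨s, rfl⟩ := key p ((dvd_pow_self _ two_ne_zero).trans h1)
    rw [sq]
    refine mul_dvd_mul_left _ (key s ?_)
    obtain ⟨u, hu⟩ : (Polynomial.X - Polynomial.C α) ∣ (minpoly F α).map (algebraMap F L) := by
      rw [dvd_iff_isRoot, IsRoot.def, eval_map_algebraMap, minpoly.aeval]
    have hsep : ((minpoly F α).map (algebraMap F L)).Separable :=
      (PerfectField.separable_of_irreducible (minpoly.irreducible hint)).map
    rw [hu] at hsep
    rw [Polynomial.map_mul, hu, sq, mul_assoc] at h1
    exact hsep.isCoprime.dvd_of_dvd_mul_left ((mul_dvd_mul_iff_left (X_sub_C_ne_zero α)).1 h1)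
  · rintro ⟨d, h1, h2, hd⟩
    have hd0 : d ≠ 0 := by
      rintro rfl
      exact hp (by simpa using h1)
    obtain ⟨α, hα⟩ := IsAlgClosed.exists_root (d.map (algebraMap F L)) (by
      rw [degree_map]
      exact fun h => hd (isUnit_iff_degree_eq_zero.2 h))
    have hα' := dvd_iff_isRoot.2 hα
    refine ⟨α, (pow_dvd_pow_of_dvd hα' 2).trans ?_, hα'.trans (Polynomial.map_dvd _ h2)⟩
    rw [← Polynomial.map_pow]
    exact Polynomial.map_dvd _ h1

lemma goodPair_iff [PerfectField F] {m n : ℕ} (c₁ : Fin (m + 1) → F) (c₂ : Fin (n + 1) → F)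
    {p r : F[X]} (hp : p.natDegree ≤ m) (hr : r.natDegree ≤ n) (h₁ : form F m c₁ = p.homogenize m)
    (h₂ : form F n c₂ = r.homogenize n) :
    GoodPair c₁ c₂ ↔ (p, r) ∈ affSet F m n ∧
      ¬ (p.natDegree + 2 ≤ m ∧ (r = 0 ∨ r.natDegree + 1 ≤ n)) := by
  set L := AlgebraicClosure F
  have hpL : (p.map (algebraMap F L)).natDegree ≤ m := by rwa [natDegree_map]
  have hrL : (r.map (algebraMap F L)).natDegree ≤ n := by rwa [natDegree_map]
  rw [GoodPair, h₁, h₂, ← homogenize_map, ← homogenize_map, Ne, homogenize_eq_zero_iff hp]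
  change _ ↔ (_ ∧ _ ∧ _ ∧ _) ∧ _
  simp only [hp, hr, true_and, ne_eq]
  by_cases hp0 : p = 0
  · simp [hp0]
  have hroot := (exists_sq_dvd_iff_exists_root (L := L) r hp0).not
  push Not at hroot
  have hassoc : ∀ (a b : L), b ≠ 0 →
      Associated (Polynomial.C b * Polynomial.X - Polynomial.C a)
        (Polynomial.X - Polynomial.C (a / b)) := by
    intro a b hb
    rw [show Polynomial.C b * Polynomial.X - Polynomial.C a =
      Polynomial.C b * (Polynomial.X - Polynomial.C (a / b)) by
        rw [mul_sub, ← Polynomial.C_mul, mul_div_cancel₀ _ hb]]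
    exact associated_unit_mul_left _ _ (isUnit_C.2 hb.isUnit)
  have hfin : ∀ (a b : L), b ≠ 0 →
      (lin a b ^ 2 ∣ (p.map (algebraMap F L)).homogenize m ∧
        lin a b ∣ (r.map (algebraMap F L)).homogenize n ↔
      (Polynomial.X - Polynomial.C (a / b)) ^ 2 ∣ p.map (algebraMap F L) ∧
        (Polynomial.X - Polynomial.C (a / b)) ∣ r.map (algebraMap F L)) := by
    intro a b hb
    rw [lin_pow_dvd_homogenize_iff hpL 2 hb, ← pow_one (lin a b),
      lin_pow_dvd_homogenize_iff hrL 1 hb, pow_one, ((hassoc a b hb).pow_pow).dvd_iff_dvd_left,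
      (hassoc a b hb).dvd_iff_dvd_left]
  have hinf : ∀ a : L, a ≠ 0 →
      (lin a 0 ^ 2 ∣ (p.map (algebraMap F L)).homogenize m ∧
        lin a 0 ∣ (r.map (algebraMap F L)).homogenize n ↔
      p.natDegree + 2 ≤ m ∧ (r = 0 ∨ r.natDegree + 1 ≤ n)) := by
    intro a ha
    rw [lin_zero_right_pow_dvd_homogenize_iff hpL 2 ha, ← pow_one (lin a 0),
      lin_zero_right_pow_dvd_homogenize_iff hrL 1 ha, Polynomial.map_eq_zero,
      Polynomial.map_eq_zero, natDegree_map, natDegree_map]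
    simp [hp0]
  refine ⟨fun h => ⟨⟨hp0, ?_⟩, ?_⟩, fun h => ⟨hp0, fun a b hab => ?_⟩⟩
  · refine hroot.1 fun α h1 h2 => h.2 α 1 (Or.inr one_ne_zero) ((hfin α 1 one_ne_zero).2 ?_)
    rw [div_one]
    exact ⟨h1, h2⟩
  · exact fun h' => h.2 1 0 (Or.inl one_ne_zero) ((hinf 1 one_ne_zero).2 h')
  · by_cases hb : b = 0
    · subst hb
      rw [hinf a (by simpa using hab)]
      exact h.2
    · rw [hfin a b hb]
      exact fun h' => hroot.2 h.1.2 _ h'.1 h'.2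

lemma card_goodPair [PerfectField F] (m n : ℕ) :
    Nat.card {x : (Fin (m + 1) → F) × (Fin (n + 1) → F) // GoodPair x.1 x.2} =
      (affSet F m n \ {x | x.1.natDegree + 2 ≤ m ∧ (x.2 = 0 ∨ x.2.natDegree + 1 ≤ n)}).ncard := by
  let f : (Fin (m + 1) → F) × (Fin (n + 1) → F) → F[X] × F[X] := fun x =>
    (((degreeLTEquiv F (m + 1)).symm x.1 : degreeLT F (m + 1)),
      ((degreeLTEquiv F (n + 1)).symm x.2 : degreeLT F (n + 1)))
  have hf : f.Injective := by
    intro x y h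
    simp only [f, Prod.mk.injEq, SetLike.coe_eq_coe, EmbeddingLike.apply_eq_iff_eq] at h
    exact Prod.ext h.1 h.2
  have hdeg : ∀ (k : ℕ) (q : degreeLT F (k + 1)), (q : F[X]).natDegree ≤ k := by
    intro k q
    have : (q : F[X]) ∈ {p : F[X] | p.natDegree ≤ k} := by
      rw [setOf_natDegree_le_eq_degreeLT]
      exact q.2
    exact this
  have hiff : ∀ x, GoodPair x.1 x.2 ↔ f x ∈ affSet F m n \
      {x | x.1.natDegree + 2 ≤ m ∧ (x.2 = 0 ∨ x.2.natDegree + 1 ≤ n)} := fun x =>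
    goodPair_iff x.1 x.2 (hdeg _ _) (hdeg _ _) (form_eq_homogenize _ _) (form_eq_homogenize _ _)
  change Nat.card ({x | GoodPair x.1 x.2} : Set ((Fin (m + 1) → F) × (Fin (n + 1) → F))) = _
  rw [Nat.card_coe_set_eq, ← Set.ncard_image_of_injective _ hf]
  congr 1
  ext ⟨p, r⟩
  simp only [Set.mem_image, Set.mem_ofPred_eq]
  constructor
  · rintro ⟨x, hx, hxe⟩
    rw [← hxe]
    exact (hiff x).1 hx
  · intro h
    have hmem : ∀ (k : ℕ) (q : F[X]), q.natDegree ≤ k → q ∈ degreeLT F (k + 1) := by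
      intro k q hq
      have : q ∈ {p : F[X] | p.natDegree ≤ k} := hq
      rw [setOf_natDegree_le_eq_degreeLT] at this
      exact this
    have hx : f (degreeLTEquiv F (m + 1) ⟨p, hmem m p h.1.1⟩,
        degreeLTEquiv F (n + 1) ⟨r, hmem n r h.1.2.1⟩) = (p, r) := by
      simp [f]
    exact ⟨_, (hiff _).2 (by rwa [hx]), hx⟩

lemma card_goodPair_of_lt_two [PerfectField F] {m : ℕ} (hm : m < 2) (n : ℕ) :
    Nat.card {x : (Fin (m + 1) → F) × (Fin (n + 1) → F) // GoodPair x.1 x.2} =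
      (affSet F m n).ncard := by
  rw [card_goodPair]
  congr 1
  ext x
  simp only [Set.mem_sdiff, Set.mem_ofPred_eq]
  constructor
  · exact fun h => h.1
  · exact fun h => ⟨h, by omega⟩

lemma card_goodPair_add_two [Finite F] (m n : ℕ) :
    Nat.card {x : (Fin (m + 2 + 1) → F) × (Fin (n + 1 + 1) → F) // GoodPair x.1 x.2} +
      (affSet F m n).ncard = (affSet F (m + 2) (n + 1)).ncard := by
  have hsub : affSet F m n ⊆ affSet F (m + 2) (n + 1) := affSet_mono (by omega) (by omega)
  rw [card_goodPair, ← Set.ncard_sdiff_add_ncard_of_subset hsub (finite_affSet _ _)]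
  congr 2
  ext ⟨p, r⟩
  simp only [affSet, Set.mem_sdiff, Set.mem_ofPred_eq]
  have : r = 0 ∨ r.natDegree + 1 ≤ n + 1 ↔ r.natDegree ≤ n := by
    constructor
    · rintro (rfl | h)
      · simp
      · omega
    · exact fun h => Or.inr (by omega)
  rw [this]
  have h2 : p.natDegree + 2 ≤ m + 2 ↔ p.natDegree ≤ m := by omega
  rw [h2]
  tauto

end Translation

section Evaluation

variable {F : Type*} [Field F] [Finite F]

lemma ncard_degSet_real (a b : ℕ) :
    ((degSet F a b).ncard : ℝ) =
      ((Nat.card F : ℝ) ^ (a + 1) - 1) * (Nat.card F : ℝ) ^ (b + 1) := by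
  rw [ncard_degSet, Nat.cast_mul, Nat.cast_sub (Nat.one_le_pow _ _ Nat.card_pos)]
  push_cast
  rfl

lemma ncard_affSet_of_lt_two {a : ℕ} (ha : a < 2) (b : ℕ) :
    ((affSet F a b).ncard : ℝ) =
      ((Nat.card F : ℝ) ^ (a + 1) - 1) * (Nat.card F : ℝ) ^ (b + 1) := by
  rw [ncard_affSet_eq_of_lt_two ha, ncard_degSet_real]

lemma ncard_affSet_add_two {a b : ℕ} (hab : a / 2 ≤ b) :
    ((affSet F (a + 2) (b + 1)).ncard : ℝ) =
      ((Nat.card F : ℝ) ^ (a + 3) - 1) * (Nat.card F : ℝ) ^ (b + 2) -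
        Nat.card F * (((Nat.card F : ℝ) ^ (a + 1) - 1) * (Nat.card F : ℝ) ^ (b + 1)) := by
  have h := congrArg (Nat.cast : ℕ → ℝ) (ncard_degSet_add_two (F := F) hab)
  rw [Nat.cast_add, Nat.cast_mul, ncard_degSet_real, ncard_degSet_real] at h
  linear_combination -h

lemma card_goodPair_one :
    (Nat.card {x : (Fin (1 + 1) → F) × (Fin (1 + 1) → F) // GoodPair x.1 x.2} : ℝ) =
      ((Nat.card F : ℝ) ^ 2 - 1) * (Nat.card F : ℝ) ^ 2 := by
  rw [card_goodPair_of_lt_two (by norm_num), ncard_affSet_of_lt_two (by norm_num)]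

lemma card_goodPair_two :
    (Nat.card {x : (Fin (2 + 1) → F) × (Fin (2 + 1) → F) // GoodPair x.1 x.2} : ℝ) =
      (Nat.card F : ℝ) ^ 6 - (Nat.card F : ℝ) ^ 4 - (Nat.card F : ℝ) ^ 3 +
        (Nat.card F : ℝ) ^ 2 := by
  have h := congrArg (Nat.cast : ℕ → ℝ) (card_goodPair_add_two (F := F) 0 1)
  rw [Nat.cast_add, ncard_affSet_of_lt_two (by norm_num), ncard_affSet_add_two (by norm_num)] at h
  simp only [zero_add] at h
  linear_combination h

lemma card_goodPair_add_three (k : ℕ) :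
    (Nat.card {x : (Fin (k + 3 + 1) → F) × (Fin (k + 3 + 1) → F) // GoodPair x.1 x.2} : ℝ) =
      (Nat.card F : ℝ) ^ (2 * k + 3) * ((Nat.card F : ℝ) ^ 5 - (Nat.card F : ℝ) ^ 3 -
        (Nat.card F : ℝ) ^ 2 + 1) := by
  have h := congrArg (Nat.cast : ℕ → ℝ) (card_goodPair_add_two (F := F) (k + 1) (k + 2))
  rw [Nat.cast_add, ncard_affSet_add_two (by omega)] at h
  rcases k with _ | k
  · rw [ncard_affSet_of_lt_two (by norm_num)] at h
    simp only [zero_add] at h ⊢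
    linear_combination h
  · rw [show k + 1 + 1 = k + 2 by rfl, show k + 1 + 2 = k + 2 + 1 by rfl,
      ncard_affSet_add_two (by omega)] at h
    linear_combination h

end Evaluation

theorem stmt0 (q e n : ℕ) (hq : 1 < q) (he : 1 ≤ e) (F : Type*) [Field F] [Fintype F]
    (hF : Fintype.card F = q ^ e) :
    (n = 1 →
      (Nat.card {p : (Fin (n + 1) → F) × (Fin (n + 1) → F) // GoodPair p.1 p.2} : ℝ) =
        (q : ℝ) ^ (e * (2 * n + 2)) * (1 - (q : ℝ) ^ (-(2 * e : ℤ)))) ∧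
    (n = 2 →
      (Nat.card {p : (Fin (n + 1) → F) × (Fin (n + 1) → F) // GoodPair p.1 p.2} : ℝ) =
        (q : ℝ) ^ (e * (2 * n + 2)) *
          (1 - (q : ℝ) ^ (-(2 * e : ℤ)) - (q : ℝ) ^ (-(3 * e : ℤ)) +
            (q : ℝ) ^ (-(4 * e : ℤ)))) ∧
    (3 ≤ n →
      (Nat.card {p : (Fin (n + 1) → F) × (Fin (n + 1) → F) // GoodPair p.1 p.2} : ℝ) =
        (q : ℝ) ^ (e * (2 * n + 2)) *
          (1 - (q : ℝ) ^ (-(2 * e : ℤ)) - (q : ℝ) ^ (-(3 * e : ℤ)) +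
            (q : ℝ) ^ (-(5 * e : ℤ)))) := by
  have hFq : (Nat.card F : ℝ) = (q : ℝ) ^ e := by
    rw [Nat.card_eq_fintype_card, hF, Nat.cast_pow]
  have hq0 : (q : ℝ) ≠ 0 := by positivity
  have hpow : ∀ k : ℕ, (q : ℝ) ^ (e * k) = (Nat.card F : ℝ) ^ k := fun k => by
    rw [hFq, pow_mul]
  have hzpow : ∀ k : ℕ, (q : ℝ) ^ (-((k : ℤ) * (e : ℤ))) = ((Nat.card F : ℝ) ^ k)⁻¹ := fun k => by
    rw [zpow_neg, ← hpow k, ← zpow_natCast, Nat.cast_mul, mul_comm]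
  have hne : (Nat.card F : ℝ) ≠ 0 := by
    rw [hFq]
    positivity
  have h2 : (q : ℝ) ^ (-(2 * e : ℤ)) = ((Nat.card F : ℝ) ^ 2)⁻¹ := hzpow 2
  have h3 : (q : ℝ) ^ (-(3 * e : ℤ)) = ((Nat.card F : ℝ) ^ 3)⁻¹ := hzpow 3
  have h4 : (q : ℝ) ^ (-(4 * e : ℤ)) = ((Nat.card F : ℝ) ^ 4)⁻¹ := hzpow 4
  have h5 : (q : ℝ) ^ (-(5 * e : ℤ)) = ((Nat.card F : ℝ) ^ 5)⁻¹ := hzpow 5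
  rw [hpow, h2, h3, h4, h5]
  refine ⟨?_, ?_, fun hn => ?_⟩
  · rintro rfl
    rw [card_goodPair_one]
    field_simp
    ring
  · rintro rfl
    rw [card_goodPair_two]
    field_simp
    ring
  · obtain ⟨k, rfl⟩ := Nat.exists_eq_add_of_le' hn
    rw [card_goodPair_add_three]
    field_simp
    ring
end

section
/- Every pair (F1, F2) with F1 a nonzero binary form of degree i and F2 a binary form of degree j over F_{q^e} factors uniquely as F1 = s_D^2 · G1 and F2 = s_D · G2, where s_D is a monic form (unique up to scalar, fixed by choosing it monic) of some degree k, G1 has degree i - 2k, G2 has degree j - k, and the pair (G1, G2) is good (G1 ≠ 0 and F no common point of a multiple root of G1 and root of G2 over the algebraic closure). -/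
open MvPolynomial

/-- A pair of binary forms is good if the first is nonzero and no geometric point of
`P^1` is simultaneously a multiple root of the first and a root of the second. -/
def GoodMv (F : Type*) [Field F] (G1 G2 : MvPolynomial (Fin 2) F) : Prop :=
  G1 ≠ 0 ∧ ∀ a b : AlgebraicClosure F, (a ≠ 0 ∨ b ≠ 0) →
    ¬ (lin a b ^ 2 ∣ G1.map (algebraMap F (AlgebraicClosure F)) ∧
       lin a b ∣ G2.map (algebraMap F (AlgebraicClosure F)))

namespace MvPolynomial

section Homogeneous

variable {σ R : Type*} [CommRing R]

/-- Scaling all variables by a new parameter; its coefficients are the homogeneous components. -/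
noncomputable def scaleVars : MvPolynomial σ R →ₐ[R] Polynomial (MvPolynomial σ R) :=
  aeval fun i => Polynomial.C (X i) * Polynomial.X

theorem scaleVars_monomial (d : σ →₀ ℕ) (r : R) :
    scaleVars (monomial d r) = Polynomial.C (monomial d r) * Polynomial.X ^ d.degree := by
  rw [scaleVars, aeval_monomial, monomial_eq (a := r), Finsupp.prod, Finsupp.prod,
    Finsupp.degree_apply, map_mul, map_prod, ← Finset.prod_pow_eq_pow_sum, mul_assoc,
    ← Finset.prod_mul_distrib]
  congr 1
  simp [mul_pow]

theorem coeff_scaleVars (p : MvPolynomial σ R) (n : ℕ) (d : σ →₀ ℕ) :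
    coeff d ((scaleVars p).coeff n) = if d.degree = n then coeff d p else 0 := by
  classical
  induction p using MvPolynomial.induction_on' with
  | monomial e a =>
    rw [scaleVars_monomial, Polynomial.coeff_C_mul_X_pow]
    by_cases hed : e = d
    · subst hed
      by_cases hn : e.degree = n
      · simp [hn]
      · simp [hn, Ne.symm hn]
    · split_ifs <;> simp [coeff_monomial, hed]
  | add p q hp hq =>
    rw [map_add, Polynomial.coeff_add, coeff_add, hp, hq, coeff_add]
    split_ifs <;> simp

theorem IsHomogeneous.scaleVars_eq {p : MvPolynomial σ R} {n : ℕ} (hp : p.IsHomogeneous n) :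
    scaleVars p = Polynomial.C p * Polynomial.X ^ n := by
  ext m d
  rw [coeff_scaleVars, Polynomial.coeff_C_mul_X_pow]
  by_cases h : coeff d p = 0
  · split_ifs <;> simp [h]
  · have hd : d.degree = n := by
      by_contra hd
      exact h (hp.coeff_eq_zero hd)
    subst hd
    by_cases hm : m = d.degree
    · simp [hm]
    · simp [hm, Ne.symm hm]

theorem isHomogeneous_of_natDegree_scaleVars_le {p : MvPolynomial σ R}
    (h : (scaleVars p).natDegree ≤ (scaleVars p).natTrailingDegree) :
    p.IsHomogeneous (scaleVars p).natDegree := by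
  intro d hd
  change Finsupp.weight (fun _ => 1) d = _
  rw [← Finsupp.degree_eq_weight_one]
  have hc := coeff_scaleVars p d.degree d
  rw [if_pos rfl] at hc
  have hne : (scaleVars p).coeff d.degree ≠ 0 := fun h0 => hd (by rw [← hc, h0, coeff_zero])
  exact le_antisymm (Polynomial.le_natDegree_of_ne_zero hne)
    (h.trans (Polynomial.natTrailingDegree_le_of_ne_zero hne))

theorem IsHomogeneous.exists_of_mul [IsDomain R] {p q : MvPolynomial σ R} {n : ℕ}
    (h : (p * q).IsHomogeneous n) (hne : p * q ≠ 0) :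
    ∃ a b, a + b = n ∧ p.IsHomogeneous a ∧ q.IsHomogeneous b := by
  have hpq := h.scaleVars_eq
  have hmono : (Polynomial.C (p * q) * Polynomial.X ^ n) ≠ 0 :=
    mul_ne_zero (Polynomial.C_ne_zero.2 hne) (pow_ne_zero _ Polynomial.X_ne_zero)
  have hmul : scaleVars p * scaleVars q ≠ 0 := by rwa [← map_mul, hpq]
  have hp := left_ne_zero_of_mul hmul
  have hq := right_ne_zero_of_mul hmul
  have hdeg : (scaleVars p).natDegree + (scaleVars q).natDegree = n := by
    rw [← Polynomial.natDegree_mul hp hq, ← map_mul, hpq, Polynomial.natDegree_C_mul_X_pow _ _ hne]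
  have htr : (scaleVars p).natTrailingDegree + (scaleVars q).natTrailingDegree = n := by
    rw [← Polynomial.natTrailingDegree_mul hp hq, ← map_mul, hpq,
      Polynomial.C_mul_X_pow_eq_monomial, Polynomial.natTrailingDegree_monomial hne]
  have h1 := Polynomial.natTrailingDegree_le_natDegree (scaleVars p)
  have h2 := Polynomial.natTrailingDegree_le_natDegree (scaleVars q)
  exact ⟨_, _, hdeg, isHomogeneous_of_natDegree_scaleVars_le (by omega),
    isHomogeneous_of_natDegree_scaleVars_le (by omega)⟩

theorem IsHomogeneous.aeval_algebraMap_mul {A : Type*} [CommRing A] [Algebra R A]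
    {p : MvPolynomial σ R} {n : ℕ} (hp : p.IsHomogeneous n) (v : σ → R) (t : A) :
    MvPolynomial.aeval (fun i => algebraMap R A (v i) * t) p =
      algebraMap R A (eval v p) * t ^ n := by
  rw [aeval_def, eval₂_eq, eval_eq, map_sum, Finset.sum_mul]
  refine Finset.sum_congr rfl fun d hd => ?_
  have hdeg : ∑ i ∈ d.support, d i = n := (hp.degree_eq_sum_deg_support hd).symm
  rw [map_mul, map_prod, mul_assoc, ← hdeg, ← Finset.prod_pow_eq_pow_sum,
    ← Finset.prod_mul_distrib]
  simp [mul_pow]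

end Homogeneous

theorem exists_map_eq_of_forall_map_algEquiv_eq {σ F K : Type*} [Field F] [Field K] [Algebra F K]
    [IsGalois F K] {p : MvPolynomial σ K} (hp : ∀ τ : K ≃ₐ[F] K, p.map (τ : K →+* K) = p) :
    ∃ p₀ : MvPolynomial σ F, p₀.map (algebraMap F K) = p := by
  change p ∈ Set.range (map (algebraMap F K))
  refine mem_range_map_iff_coeffs_subset.2 ?_
  intro c hc
  obtain ⟨d, -, rfl⟩ := mem_coeffs_iff.1 hc
  refine (InfiniteGalois.mem_range_algebraMap_iff_fixed _).2 fun τ => ?_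
  have := congrArg (coeff d) (hp τ)
  rwa [coeff_map] at this

end MvPolynomial

section BinaryForms

variable {K : Type*} [Field K]

theorem isHomogeneous_lin (a b : K) : (lin a b).IsHomogeneous 1 :=
  (isHomogeneous_C_mul_X b 0).sub (isHomogeneous_C_mul_X a 1)

theorem map_lin {L : Type*} [Field L] (f : K →+* L) (a b : K) :
    (lin a b).map f = lin (f a) (f b) := by
  simp [lin]

theorem lin_dvd_of_eval_eq_zero {a b : K} (hab : a ≠ 0 ∨ b ≠ 0) {n : ℕ}
    {P : MvPolynomial (Fin 2) K} (hP : P.IsHomogeneous n) (h : eval ![a, b] P = 0) :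
    lin a b ∣ P := by
  rw [← Ideal.mem_span_singleton, ← Ideal.Quotient.eq_zero_iff_mem]
  set π := Ideal.Quotient.mkₐ K (Ideal.span {lin a b})
  change π P = 0
  have hlin : π (C b * X 0) = π (C a * X 1) := by
    rw [← sub_eq_zero, ← map_sub]
    exact Ideal.Quotient.eq_zero_iff_mem.2 (Ideal.mem_span_singleton_self _)
  obtain ⟨t, ht⟩ : ∃ t, ∀ i, π (X i) = algebraMap K _ (![a, b] i) * t := by
    have hC : ∀ c : K, π (C c) = algebraMap K _ c := fun c => π.commutes c
    rw [map_mul, map_mul, hC, hC] at hlin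
    have key : ∀ c : K, c ≠ 0 → algebraMap K (MvPolynomial (Fin 2) K ⧸ Ideal.span {lin a b}) c *
        algebraMap K _ c⁻¹ = 1 := fun c hc => by
      rw [← map_mul, mul_inv_cancel₀ hc, map_one]
    rcases hab with ha | hb
    · refine ⟨algebraMap K _ a⁻¹ * π (X 0), Fin.forall_fin_two.2 ⟨?_, ?_⟩⟩
      · simp only [Matrix.cons_val_zero]
        linear_combination (-π (X 0)) * key a ha
      · simp only [Matrix.cons_val_one, Matrix.cons_val_fin_one]
        linear_combination (-π (X 1)) * key a ha - algebraMap K _ a⁻¹ * hlin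
    · refine ⟨algebraMap K _ b⁻¹ * π (X 1), Fin.forall_fin_two.2 ⟨?_, ?_⟩⟩
      · simp only [Matrix.cons_val_zero]
        linear_combination (-π (X 0)) * key b hb + algebraMap K _ b⁻¹ * hlin
      · simp only [Matrix.cons_val_one, Matrix.cons_val_fin_one]
        linear_combination (-π (X 1)) * key b hb
  rw [DFunLike.congr_fun (aeval_unique π) P]
  simp only [Function.comp_def, ht]
  rw [hP.aeval_algebraMap_mul, h, map_zero, zero_mul]

theorem exists_lin_dvd [IsAlgClosed K] {n : ℕ} (hn : n ≠ 0) {P : MvPolynomial (Fin 2) K}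
    (hP : P.IsHomogeneous n) : ∃ a b : K, (a ≠ 0 ∨ b ≠ 0) ∧ lin a b ∣ P := by
  suffices ∃ a b : K, (a ≠ 0 ∨ b ≠ 0) ∧ eval ![a, b] P = 0 by
    obtain ⟨a, b, hab, h⟩ := this
    exact ⟨a, b, hab, lin_dvd_of_eval_eq_zero hab hP h⟩
  have heval : ∀ (v : Fin 2 → Polynomial K) (x : K),
      (aeval v P).eval x = eval (fun i => (v i).eval x) P := fun v x => by
    rw [← Polynomial.coe_evalRingHom, aeval_def, eval₂_comp_left]
    have hid : (Polynomial.evalRingHom x).comp (algebraMap K (Polynomial K)) = RingHom.id K := by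
      ext
      simp
    rw [hid]
    rfl
  set g : Polynomial K := aeval ![Polynomial.X, 1] P with hg
  have hgx : ∀ x, g.eval x = eval ![x, 1] P := fun x => by
    rw [hg, heval]
    congr 2
    ext i
    fin_cases i <;> simp
  by_cases hdeg : g.degree = 0
  · refine ⟨1, 0, Or.inl one_ne_zero, ?_⟩
    obtain ⟨c, hc⟩ : ∃ c, g = Polynomial.C c := ⟨_, Polynomial.eq_C_of_degree_eq_zero hdeg⟩
    set h : Polynomial K := aeval ![1, Polynomial.X] P with hh
    have hhx : ∀ x, h.eval x = eval ![1, x] P := fun x => by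
      rw [hh, heval]
      congr 2
      ext i
      fin_cases i <;> simp
    have key : Polynomial.X * (h - Polynomial.C c * Polynomial.X ^ n) = 0 := by
      refine Polynomial.funext fun x => ?_
      obtain rfl | hx := eq_or_ne x 0
      · simp
      · have := hP.aeval_algebraMap_mul ![x⁻¹, 1] x
        have hv : (fun i => algebraMap K K (![x⁻¹, 1] i) * x) = ![1, x] := by
          ext i
          fin_cases i <;> simp [hx]
        rw [hv, ← hgx, hc, Polynomial.eval_C, aeval_eq_eval, ← hhx] at this
        simp [this]
    have h0 := (mul_eq_zero.1 key).resolve_left Polynomial.X_ne_zero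
    rw [← hhx, sub_eq_zero.1 h0]
    simp [hn]
  · obtain ⟨x, hx⟩ := IsAlgClosed.exists_root g hdeg
    exact ⟨x, 1, Or.inr one_ne_zero, by rw [← hgx, hx.eq_zero]⟩

theorem dvd_of_no_common_lin [IsAlgClosed K] {n : ℕ}
    {s s' F1 F2 G1 G2 G1' G2' : MvPolynomial (Fin 2) K} (hF : F1.IsHomogeneous n) (hne : F1 ≠ 0)
    (h1 : F1 = s ^ 2 * G1) (h2 : F2 = s * G2) (h1' : F1 = s' ^ 2 * G1') (h2' : F2 = s' * G2')
    (hgood : ∀ a b : K, (a ≠ 0 ∨ b ≠ 0) → ¬ (lin a b ^ 2 ∣ G1 ∧ lin a b ∣ G2)) : s' ∣ s := by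
  classical
  let := UniqueFactorizationMonoid.toGCDMonoid (MvPolynomial (Fin 2) K)
  have hs' : s' ≠ 0 := by
    rintro rfl
    simp [h1'] at hne
  obtain ⟨u, v, hu, hv, huv⟩ := extract_gcd s s'
  set d := gcd s s'
  have hd : d ≠ 0 := by
    intro h
    rw [h, zero_mul] at hv
    exact hs' hv
  have hrel : IsRelPrime v u := (gcd_isUnit_iff_isRelPrime.1 huv).symm
  have hv1 : v ^ 2 ∣ G1 := by
    have : u ^ 2 * G1 = v ^ 2 * G1' := by
      refine mul_left_cancel₀ (pow_ne_zero 2 hd) ?_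
      rw [← mul_assoc, ← mul_assoc, ← mul_pow, ← mul_pow, ← hu, ← hv, ← h1, ← h1']
    exact (hrel.pow (m := 2) (n := 2)).dvd_of_dvd_mul_left ⟨_, this⟩
  have hv2 : v ∣ G2 := by
    have : u * G2 = v * G2' := by
      refine mul_left_cancel₀ hd ?_
      rw [← mul_assoc, ← mul_assoc, ← hu, ← hv, ← h2, ← h2']
    exact hrel.dvd_of_dvd_mul_left ⟨_, this⟩
  have hFv : F1 = v * (d * (s' * G1')) := by
    rw [h1', hv]
    ring
  obtain ⟨m, -, -, hm, -⟩ := IsHomogeneous.exists_of_mul (hFv ▸ hF) (hFv ▸ hne)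
  have hv0 : v ≠ 0 := by
    rintro rfl
    exact hs' (by rw [hv, mul_zero])
  obtain rfl | hm0 := eq_or_ne m 0
  · have hvu : IsUnit v := by
      have hC := totalDegree_eq_zero_iff_eq_C.1 ((totalDegree_zero_iff_isHomogeneous _).2 hm)
      rw [hC] at hv0 ⊢
      exact (isUnit_iff_ne_zero.2 fun h => hv0 (by rw [h, C_0])).map C
    rw [hv]
    exact hvu.mul_right_dvd.2 ⟨u, hu⟩
  · obtain ⟨a, b, hab, hl⟩ := exists_lin_dvd hm0 hm
    exact absurd ⟨(pow_dvd_pow_of_dvd hl 2).trans hv1, hl.trans hv2⟩ (hgood a b hab)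

theorem exists_factorization_no_common_lin (n : ℕ) {F1 : MvPolynomial (Fin 2) K}
    (F2 : MvPolynomial (Fin 2) K) (hF : F1.IsHomogeneous n) (hne : F1 ≠ 0) :
    ∃ s G1 G2, F1 = s ^ 2 * G1 ∧ F2 = s * G2 ∧
      ∀ a b : K, (a ≠ 0 ∨ b ≠ 0) → ¬ (lin a b ^ 2 ∣ G1 ∧ lin a b ∣ G2) := by
  induction n using Nat.strong_induction_on generalizing F1 F2 with
  | _ n ih =>
    by_cases hgood : ∀ a b : K, (a ≠ 0 ∨ b ≠ 0) → ¬ (lin a b ^ 2 ∣ F1 ∧ lin a b ∣ F2)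
    · exact ⟨1, F1, F2, by simp, by simp, hgood⟩
    · push Not at hgood
      obtain ⟨a, b, -, ⟨H1, rfl⟩, ⟨H2, rfl⟩⟩ := hgood
      obtain ⟨k, l, hkl, hk, hl⟩ := hF.exists_of_mul hne
      have hk2 := hk.inj_right ((isHomogeneous_lin a b).pow 2) (left_ne_zero_of_mul hne)
      obtain ⟨s, G1, G2, h1, h2, hG⟩ := ih l (by omega) H2 hl (right_ne_zero_of_mul hne)
      exact ⟨lin a b * s, G1, G2, by rw [h1]; ring, by rw [h2]; ring, hG⟩

theorem exists_eq_C_mul_of_no_common_lin [IsAlgClosed K] {n : ℕ}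
    {s s' F1 F2 G1 G2 G1' G2' : MvPolynomial (Fin 2) K} (hF : F1.IsHomogeneous n) (hne : F1 ≠ 0)
    (h1 : F1 = s ^ 2 * G1) (h2 : F2 = s * G2) (h1' : F1 = s' ^ 2 * G1') (h2' : F2 = s' * G2')
    (hgood : ∀ a b : K, (a ≠ 0 ∨ b ≠ 0) → ¬ (lin a b ^ 2 ∣ G1 ∧ lin a b ∣ G2))
    (hgood' : ∀ a b : K, (a ≠ 0 ∨ b ≠ 0) → ¬ (lin a b ^ 2 ∣ G1' ∧ lin a b ∣ G2')) :
    ∃ c : K, s' = C c * s := by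
  obtain ⟨u, hu⟩ := associated_of_dvd_dvd
    (dvd_of_no_common_lin hF hne h1' h2' h1 h2 hgood')
    (dvd_of_no_common_lin hF hne h1 h2 h1' h2' hgood)
  obtain ⟨c, -, hc⟩ := isUnit_iff_eq_C_of_isReduced.1 u.isUnit
  exact ⟨c, by rw [← hu, hc, mul_comm]⟩

/-- The factorization over an algebraically closed Galois extension descends to the base field. -/
theorem exists_factorization_descent {F : Type*} [Field F] [Algebra F K] [IsAlgClosed K]
    [IsGalois F K] {n : ℕ} {F1 F2 : MvPolynomial (Fin 2) F} (hF : F1.IsHomogeneous n)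
    (hne : F1 ≠ 0) :
    ∃ s G1 G2 : MvPolynomial (Fin 2) F, F1 = s ^ 2 * G1 ∧ F2 = s * G2 ∧
      ∀ a b : K, (a ≠ 0 ∨ b ≠ 0) → ¬ (lin a b ^ 2 ∣ G1.map (algebraMap F K) ∧
        lin a b ∣ G2.map (algebraMap F K)) := by
  have hinj := map_injective (σ := Fin 2) (algebraMap F K) (algebraMap F K).injective
  have hKF := hF.map (algebraMap F K)
  have hKne : F1.map (algebraMap F K) ≠ 0 := fun h => hne (hinj (by rw [h, map_zero]))
  obtain ⟨s, G1, G2, h1, h2, hgood, m, hm⟩ : ∃ s G1 G2 : MvPolynomial (Fin 2) K,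
      F1.map (algebraMap F K) = s ^ 2 * G1 ∧ F2.map (algebraMap F K) = s * G2 ∧
      (∀ a b : K, (a ≠ 0 ∨ b ≠ 0) → ¬ (lin a b ^ 2 ∣ G1 ∧ lin a b ∣ G2)) ∧
      ∃ m, coeff m s = 1 := by
    obtain ⟨s, G1, G2, h1, h2, hgood⟩ :=
      exists_factorization_no_common_lin n (F2.map (algebraMap F K)) hKF hKne
    have hs : s ≠ 0 := by
      rintro rfl
      simp [h1] at hKne
    obtain ⟨m, hm⟩ := ne_zero_iff.1 hs
    have hcc : (C (coeff m s)⁻¹ * C (coeff m s) : MvPolynomial (Fin 2) K) = 1 := by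
      rw [← C_mul, inv_mul_cancel₀ hm, C_1]
    have hunit : IsUnit (C (coeff m s) : MvPolynomial (Fin 2) K) :=
      (isUnit_iff_ne_zero.2 hm).map C
    refine ⟨C (coeff m s)⁻¹ * s, C (coeff m s) ^ 2 * G1, C (coeff m s) * G2, ?_, ?_, ?_, m, ?_⟩
    · rw [h1]
      linear_combination (-s ^ 2 * G1 * (C (coeff m s)⁻¹ * C (coeff m s) + 1)) * hcc
    · rw [h2]
      linear_combination (-s * G2) * hcc
    · simpa only [(hunit.pow 2).dvd_mul_left, hunit.dvd_mul_left] using hgood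
    · rw [coeff_C_mul, inv_mul_cancel₀ hm]
  have hs : s ≠ 0 := by
    rintro rfl
    simp at hm
  have hfix : ∀ (τ : K ≃ₐ[F] K) (P : MvPolynomial (Fin 2) F),
      (P.map (algebraMap F K)).map (τ : K →+* K) = P.map (algebraMap F K) := fun τ P => by
    rw [map_map]
    congr 2
    exact τ.toAlgHom.comp_algebraMap
  have hτ1 : ∀ τ : K ≃ₐ[F] K, F1.map (algebraMap F K) =
      s.map (τ : K →+* K) ^ 2 * G1.map (τ : K →+* K) := fun τ => by
    rw [← map_pow, ← map_mul, ← h1, hfix]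
  have hτ2 : ∀ τ : K ≃ₐ[F] K, F2.map (algebraMap F K) =
      s.map (τ : K →+* K) * G2.map (τ : K →+* K) := fun τ => by
    rw [← map_mul, ← h2, hfix]
  have hsτ : ∀ τ : K ≃ₐ[F] K, s.map (τ : K →+* K) = s := by
    intro τ
    have hback : ∀ {a b : K} {k : ℕ} {P : MvPolynomial (Fin 2) K},
        lin a b ^ k ∣ P.map (τ : K →+* K) → lin (τ.symm a) (τ.symm b) ^ k ∣ P := by
      intro a b k P h
      have := map_dvd (map (τ.symm : K →+* K)) h
      rw [map_pow, map_lin, map_map] at this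
      have hid : (τ.symm : K →+* K).comp (τ : K →+* K) = RingHom.id K := by
        ext x
        simp
      rwa [hid, map_id] at this
    obtain ⟨c, hc⟩ := exists_eq_C_mul_of_no_common_lin hKF hKne h1 h2 (hτ1 τ) (hτ2 τ) hgood
      fun a b hab h => hgood (τ.symm a) (τ.symm b) (by simpa using hab)
        ⟨hback h.1, by simpa using hback (k := 1) (by simpa using h.2)⟩
    have hc1 := congrArg (coeff m) hc
    rw [coeff_map, coeff_C_mul, hm, map_one, mul_one] at hc1
    rw [hc, ← hc1, C_1, one_mul]
  obtain ⟨s₀, rfl⟩ := exists_map_eq_of_forall_map_algEquiv_eq hsτ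
  obtain ⟨H1, rfl⟩ := exists_map_eq_of_forall_map_algEquiv_eq (F := F) (p := G1) fun τ => by
    refine mul_left_cancel₀ (pow_ne_zero 2 hs) ?_
    rw [← h1, hτ1 τ, hsτ]
  obtain ⟨H2, rfl⟩ := exists_map_eq_of_forall_map_algEquiv_eq (F := F) (p := G2) fun τ => by
    refine mul_left_cancel₀ hs ?_
    rw [← h2, hτ2 τ, hsτ]
  exact ⟨s₀, H1, H2, hinj (by rw [h1, map_mul, map_pow]), hinj (by rw [h2, map_mul]), hgood⟩

end BinaryForms

theorem stmt2 (F : Type*) [Field F] [Fintype F] (i j : ℕ)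
    (F1 F2 : MvPolynomial (Fin 2) F) (h1 : F1.IsHomogeneous i) (hne : F1 ≠ 0)
    (h2 : F2.IsHomogeneous j) :
    ∃ (k : ℕ) (sD G1 G2 : MvPolynomial (Fin 2) F),
      2 * k ≤ i ∧ sD.IsHomogeneous k ∧ G1.IsHomogeneous (i - 2 * k) ∧
      G2.IsHomogeneous (j - k) ∧ F1 = sD ^ 2 * G1 ∧ F2 = sD * G2 ∧ GoodMv F G1 G2 ∧
      ∀ (k' : ℕ) (sD' G1' G2' : MvPolynomial (Fin 2) F),
        2 * k' ≤ i → sD'.IsHomogeneous k' → G1'.IsHomogeneous (i - 2 * k') →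
        G2'.IsHomogeneous (j - k') → F1 = sD' ^ 2 * G1' → F2 = sD' * G2' →
        GoodMv F G1' G2' → ∃ c : F, c ≠ 0 ∧ sD' = MvPolynomial.C c * sD := by
  set K := AlgebraicClosure F
  obtain ⟨s, G1, G2, e1, e2, hgood⟩ := exists_factorization_descent (K := K) (F2 := F2) h1 hne
  have hs : s ≠ 0 := by
    rintro rfl
    simp [e1] at hne
  have hG1 : G1 ≠ 0 := by
    rintro rfl
    simp [e1] at hne
  obtain ⟨k2, l, hkl, hk2, hl⟩ := IsHomogeneous.exists_of_mul (e1 ▸ h1) (e1 ▸ hne)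
  have hs2 : s * s ≠ 0 := mul_ne_zero hs hs
  obtain ⟨k, k', hkk, hk, hk'⟩ := IsHomogeneous.exists_of_mul (pow_two s ▸ hk2) hs2
  obtain rfl := hk.inj_right hk' hs
  refine ⟨k, s, G1, G2, by omega, hk, ?_, ?_, e1, e2, ⟨hG1, hgood⟩, ?_⟩
  · rwa [show i - 2 * k = l by omega]
  · obtain rfl | hG2 := eq_or_ne G2 0
    · exact isHomogeneous_zero _ _ _
    · obtain ⟨a, b, hab, ha, hb⟩ := IsHomogeneous.exists_of_mul (e2 ▸ h2) (mul_ne_zero hs hG2)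
      obtain rfl := hk.inj_right ha hs
      rwa [show j - k = b by omega]
  · intro _ s' G1' G2' _ _ _ _ e1' e2' hgood'
    have hinj := map_injective (σ := Fin 2) (algebraMap F K) (algebraMap F K).injective
    obtain ⟨c, hc⟩ := exists_eq_C_mul_of_no_common_lin (F2 := F2.map (algebraMap F K))
      (h1.map (algebraMap F K)) (fun h => hne (hinj (by rw [h, map_zero])))
      (by rw [e1, map_mul, map_pow]) (by rw [e2, map_mul])
      (by rw [e1', map_mul, map_pow]) (by rw [e2', map_mul]) hgood hgood'.2
    obtain ⟨m, hm⟩ := ne_zero_iff.1 hs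
    have hcm := congrArg (coeff m) hc
    rw [coeff_map, coeff_C_mul, coeff_map] at hcm
    have hc' : c = algebraMap F K (coeff m s' / coeff m s) := by
      rw [map_div₀, hcm, mul_div_cancel_right₀]
      simpa using hm
    have heq : s' = C (coeff m s' / coeff m s) * s := hinj (by rw [map_mul, map_C, ← hc', hc])
    refine ⟨_, fun h0 => hne ?_, heq⟩
    rw [h0, C_0, zero_mul] at heq
    rw [e1', heq]
    ring
end
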